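/- Take B = k[T, T^{-1}] the Laurent polynomial algebra, x = T, y = 1, and let I be the two-sided ideal of Â(0,0) generated by the element aa^* + e₀ − T. Then the quotient pointed k-category Â/I is isomorphic to the localized path category Ã by an isomorphism that is the identity on objects and sends a ↦ a, a^* ↦ a^*, and T ↦ T = e₀ + aa^*; moreover this isomorphism intertwines the Crisp–Paris-type Yang–Baxter operator induced on (Â/I)^{(2)} with the GMV operator σ on Ã^{(2)} (given by a₁ ↦ T₁a₂, a₁^* ↦ a₂^*T₁^{-1}, a₂ ↦ a₁, a₂^* ↦ a₁^*). -/

import Mathlib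

/-!
STATEMENT 16: Take B = k[T,T⁻¹], x = T, y = 1, and let I be the two-sided ideal
of Â(0,0) generated by aa^* + e₀ − T. Then the quotient pointed k-category Â/I
is isomorphic to the localized path category Ã by an identity-on-objects
isomorphism sending a ↦ a, a^* ↦ a^*, T ↦ e₀ + aa^*; moreover this isomorphism
intertwines the Crisp–Paris-type Yang–Baxter operator induced on (Â/I)^{(2)}
with the GMV operator σ on Ã^{(2)}.
-/

/-- Generators of the `k`-category `Ã^{(n)}` (encoded as a `k`-algebra with
idempotents `e_i` corresponding to the objects `{0, 1, …, n}`): the identities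
`e_i`, the arrows `a_i : i → 0` and `a_i^* : 0 → i`, and the formal inverses
`t_i` of the endomorphisms `T_i = e₀ + a_i a_i^*` of the object `0`. -/
inductive TGen (n : ℕ) : Type
  | e : Fin (n + 1) → TGen n
  | a : Fin n → TGen n
  | as : Fin n → TGen n
  | t : Fin n → TGen n

variable (k : Type) [CommRing k]

/-- The defining relations of `Ã^{(n)}`: the `e_i` are orthogonal idempotents
summing to `1` (encoding the objects), the arrows are placed in the correct
hom-components (`a_i = e₀ a_i e_i` etc., where object `i ∈ {1,…,n}` is encoded as
`(i : Fin n).succ`), and `t_i` is a two-sided inverse of `T_i = e₀ + a_i a_i^*`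
in the endomorphism algebra of the object `0`. -/
inductive TRel (n : ℕ) : FreeAlgebra k (TGen n) → FreeAlgebra k (TGen n) → Prop
  | idem (i : Fin (n + 1)) :
      TRel n (FreeAlgebra.ι k (TGen.e i) * FreeAlgebra.ι k (TGen.e i)) (FreeAlgebra.ι k (TGen.e i))
  | orth (i j : Fin (n + 1)) (h : i ≠ j) :
      TRel n (FreeAlgebra.ι k (TGen.e i) * FreeAlgebra.ι k (TGen.e j)) 0
  | esum : TRel n (∑ i : Fin (n + 1), FreeAlgebra.ι k (TGen.e i)) 1
  | aL (i : Fin n) :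
      TRel n (FreeAlgebra.ι k (TGen.e 0) * FreeAlgebra.ι k (TGen.a i)) (FreeAlgebra.ι k (TGen.a i))
  | aR (i : Fin n) :
      TRel n (FreeAlgebra.ι k (TGen.a i) * FreeAlgebra.ι k (TGen.e i.succ)) (FreeAlgebra.ι k (TGen.a i))
  | asL (i : Fin n) :
      TRel n (FreeAlgebra.ι k (TGen.e i.succ) * FreeAlgebra.ι k (TGen.as i)) (FreeAlgebra.ι k (TGen.as i))
  | asR (i : Fin n) :
      TRel n (FreeAlgebra.ι k (TGen.as i) * FreeAlgebra.ι k (TGen.e 0)) (FreeAlgebra.ι k (TGen.as i))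
  | tL (i : Fin n) :
      TRel n (FreeAlgebra.ι k (TGen.e 0) * FreeAlgebra.ι k (TGen.t i)) (FreeAlgebra.ι k (TGen.t i))
  | tR (i : Fin n) :
      TRel n (FreeAlgebra.ι k (TGen.t i) * FreeAlgebra.ι k (TGen.e 0)) (FreeAlgebra.ι k (TGen.t i))
  | tinvR (i : Fin n) :
      TRel n ((FreeAlgebra.ι k (TGen.e 0) + FreeAlgebra.ι k (TGen.a i) * FreeAlgebra.ι k (TGen.as i)) *
        FreeAlgebra.ι k (TGen.t i)) (FreeAlgebra.ι k (TGen.e 0))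
  | tinvL (i : Fin n) :
      TRel n (FreeAlgebra.ι k (TGen.t i) *
        (FreeAlgebra.ι k (TGen.e 0) + FreeAlgebra.ι k (TGen.a i) * FreeAlgebra.ι k (TGen.as i)))
        (FreeAlgebra.ι k (TGen.e 0))

/-- The `k`-category `Ã^{(n)}` (the localized path category), encoded as a
`k`-algebra with idempotents: the `n`-fold fusion coproduct of copies of `Ã`. -/
abbrev TAlg (n : ℕ) : Type := RingQuot (TRel k n)

/-- The idempotent `e_i` corresponding to the object `i ∈ {0, 1, …, n}`. -/
noncomputable def eT (n : ℕ) (i : Fin (n + 1)) : TAlg k n :=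
  RingQuot.mkAlgHom k (TRel k n) (FreeAlgebra.ι k (TGen.e i))

/-- The generating morphism `a_i : i → 0`. -/
noncomputable def aT (n : ℕ) (i : Fin n) : TAlg k n :=
  RingQuot.mkAlgHom k (TRel k n) (FreeAlgebra.ι k (TGen.a i))

/-- The generating morphism `a_i^* : 0 → i`. -/
noncomputable def asT (n : ℕ) (i : Fin n) : TAlg k n :=
  RingQuot.mkAlgHom k (TRel k n) (FreeAlgebra.ι k (TGen.as i))

/-- The inverse `T_i^{-1}` of `T_i`. -/
noncomputable def tinvT (n : ℕ) (i : Fin n) : TAlg k n :=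
  RingQuot.mkAlgHom k (TRel k n) (FreeAlgebra.ι k (TGen.t i))

/-- The invertible endomorphism `T_i = e₀ + a_i a_i^*` of the object `0`. -/
noncomputable def TT (n : ℕ) (i : Fin n) : TAlg k n :=
  eT k n 0 + aT k n i * asT k n i

/-- The strand `i` (as an index in `Fin n`). -/
def lo {n : ℕ} (i : Fin (n - 1)) : Fin n := ⟨i.1, by have := i.isLt; omega⟩
/-- The strand `i+1` (as an index in `Fin n`). -/
def hi {n : ℕ} (i : Fin (n - 1)) : Fin n := ⟨i.1 + 1, by have := i.isLt; omega⟩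

/-- The Gelfand–MacPherson–Vilonen assignments for the generator `σ_i` acting on
`Ã^{(n)}`: it swaps the objects `i` and `i+1`, fixes the other objects, and sends
`a_i ↦ T_i a_{i+1}`, `a_{i+1} ↦ a_i`, `a_i^* ↦ a_{i+1}^* T_i^{-1}`,
`a_{i+1}^* ↦ a_i^*`, fixing `a_j, a_j^*` for `j ≠ i, i+1`. -/
def IsGMVAt (n : ℕ) (i : Fin (n - 1)) (σ : TAlg k n → TAlg k n) : Prop :=
  σ (eT k n 0) = eT k n 0 ∧
  σ (eT k n (lo i).succ) = eT k n (hi i).succ ∧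
  σ (eT k n (hi i).succ) = eT k n (lo i).succ ∧
  (∀ j : Fin n, j ≠ lo i → j ≠ hi i → σ (eT k n j.succ) = eT k n j.succ) ∧
  σ (aT k n (lo i)) = TT k n (lo i) * aT k n (hi i) ∧
  σ (aT k n (hi i)) = aT k n (lo i) ∧
  σ (asT k n (lo i)) = asT k n (hi i) * tinvT k n (lo i) ∧
  σ (asT k n (hi i)) = asT k n (lo i) ∧
  (∀ j : Fin n, j ≠ lo i → j ≠ hi i →
    σ (aT k n j) = aT k n j ∧ σ (asT k n j) = asT k n j)

/-- Generators of the pointed `k`-category `Â^{(n)}` (encoded as a `k`-algebra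
with idempotents `e_i` for the objects `{0,1,…,n}`): the identities `e_i`, the
freely adjoined arrows `a_i : i → 0` and `a_i^* : 0 → i`, and for each `i` a copy
`b_i(x)` (`x ∈ B`) of the algebra `B` inside the endomorphisms of the object `0`
(the free product `B^{*n} ⊆ End(0)`). -/
inductive HGen (B : Type) (n : ℕ) : Type
  | e : Fin (n + 1) → HGen B n
  | a : Fin n → HGen B n
  | as : Fin n → HGen B n
  | b : Fin n → B → HGen B n

variable (B : Type) [Ring B] [Algebra k B]

/-- The defining relations of `Â^{(n)}`: the `e_i` are orthogonal idempotents
summing to `1`, the arrows sit in the correct hom-components, and each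
`b_i : B → e₀·Â^{(n)}·e₀` is a `k`-algebra homomorphism (with `b_i(1) = e₀`),
so that `End(0)` contains the free product `B^{*n}`. -/
inductive HRel (n : ℕ) : FreeAlgebra k (HGen B n) → FreeAlgebra k (HGen B n) → Prop
  | idem (i : Fin (n + 1)) :
      HRel n (FreeAlgebra.ι k (HGen.e i) * FreeAlgebra.ι k (HGen.e i)) (FreeAlgebra.ι k (HGen.e i))
  | orth (i j : Fin (n + 1)) (h : i ≠ j) :
      HRel n (FreeAlgebra.ι k (HGen.e i) * FreeAlgebra.ι k (HGen.e j)) 0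
  | esum : HRel n (∑ i : Fin (n + 1), FreeAlgebra.ι k (HGen.e i)) 1
  | aL (i : Fin n) :
      HRel n (FreeAlgebra.ι k (HGen.e 0) * FreeAlgebra.ι k (HGen.a i)) (FreeAlgebra.ι k (HGen.a i))
  | aR (i : Fin n) :
      HRel n (FreeAlgebra.ι k (HGen.a i) * FreeAlgebra.ι k (HGen.e i.succ)) (FreeAlgebra.ι k (HGen.a i))
  | asL (i : Fin n) :
      HRel n (FreeAlgebra.ι k (HGen.e i.succ) * FreeAlgebra.ι k (HGen.as i)) (FreeAlgebra.ι k (HGen.as i))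
  | asR (i : Fin n) :
      HRel n (FreeAlgebra.ι k (HGen.as i) * FreeAlgebra.ι k (HGen.e 0)) (FreeAlgebra.ι k (HGen.as i))
  | bL (i : Fin n) (x : B) :
      HRel n (FreeAlgebra.ι k (HGen.e 0) * FreeAlgebra.ι k (HGen.b i x)) (FreeAlgebra.ι k (HGen.b i x))
  | bR (i : Fin n) (x : B) :
      HRel n (FreeAlgebra.ι k (HGen.b i x) * FreeAlgebra.ι k (HGen.e 0)) (FreeAlgebra.ι k (HGen.b i x))
  | badd (i : Fin n) (x y : B) :
      HRel n (FreeAlgebra.ι k (HGen.b i (x + y)))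
        (FreeAlgebra.ι k (HGen.b i x) + FreeAlgebra.ι k (HGen.b i y))
  | bmul (i : Fin n) (x y : B) :
      HRel n (FreeAlgebra.ι k (HGen.b i (x * y)))
        (FreeAlgebra.ι k (HGen.b i x) * FreeAlgebra.ι k (HGen.b i y))
  | bone (i : Fin n) :
      HRel n (FreeAlgebra.ι k (HGen.b i 1)) (FreeAlgebra.ι k (HGen.e 0))
  | bsmul (i : Fin n) (c : k) (x : B) :
      HRel n (FreeAlgebra.ι k (HGen.b i (c • x))) (c • FreeAlgebra.ι k (HGen.b i x))

/-- The pointed `k`-category `Â^{(n)}` (pointed at the object `0`), encoded as a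
`k`-algebra with idempotents: the `n`-fold fusion coproduct of copies of `Â`. -/
abbrev HAlg (n : ℕ) : Type := RingQuot (HRel k B n)

/-- The idempotent `e_i` corresponding to the object `i ∈ {0,1,…,n}`. -/
noncomputable def eH (n : ℕ) (i : Fin (n + 1)) : HAlg k B n :=
  RingQuot.mkAlgHom k (HRel k B n) (FreeAlgebra.ι k (HGen.e i))

/-- The generating morphism `a_i : i → 0`. -/
noncomputable def aH (n : ℕ) (i : Fin n) : HAlg k B n :=
  RingQuot.mkAlgHom k (HRel k B n) (FreeAlgebra.ι k (HGen.a i))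

/-- The generating morphism `a_i^* : 0 → i`. -/
noncomputable def asH (n : ℕ) (i : Fin n) : HAlg k B n :=
  RingQuot.mkAlgHom k (HRel k B n) (FreeAlgebra.ι k (HGen.as i))

/-- The image `b_i = x_i` of `x ∈ B` in the `i`-th free factor of
`B^{*n} ⊆ End(0)`. -/
noncomputable def bH (n : ℕ) (i : Fin n) (x : B) : HAlg k B n :=
  RingQuot.mkAlgHom k (HRel k B n) (FreeAlgebra.ι k (HGen.b i x))


/-- The Crisp–Paris-type assignments for the generator `σ_i` acting on `Â^{(n)}`
(for invertible commuting `x, y ∈ B`): it swaps the objects `i` and `i+1`, fixes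
the other objects, and sends `a_i ↦ x_i a_{i+1}`, `a_i^* ↦ a_{i+1}^* x_i^{-1}`,
`b_i ↦ x_i b_{i+1} x_i^{-1}`, `a_{i+1} ↦ y_i a_i`, `a_{i+1}^* ↦ a_i^* y_i^{-1}`,
`b_{i+1} ↦ y_i b_i y_i^{-1}`, fixing `a_j, a_j^*, b_j` for `j ≠ i, i+1`. -/
def IsCPAt (x y : Bˣ) (n : ℕ) (i : Fin (n - 1)) (σ : HAlg k B n → HAlg k B n) : Prop :=
  σ (eH k B n 0) = eH k B n 0 ∧
  σ (eH k B n (lo i).succ) = eH k B n (hi i).succ ∧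
  σ (eH k B n (hi i).succ) = eH k B n (lo i).succ ∧
  (∀ j : Fin n, j ≠ lo i → j ≠ hi i → σ (eH k B n j.succ) = eH k B n j.succ) ∧
  σ (aH k B n (lo i)) = bH k B n (lo i) (x : B) * aH k B n (hi i) ∧
  σ (asH k B n (lo i)) = asH k B n (hi i) * bH k B n (lo i) ((x⁻¹ : Bˣ) : B) ∧
  (∀ z : B, σ (bH k B n (lo i) z) =
    bH k B n (lo i) (x : B) * bH k B n (hi i) z * bH k B n (lo i) ((x⁻¹ : Bˣ) : B)) ∧
  σ (aH k B n (hi i)) = bH k B n (lo i) (y : B) * aH k B n (lo i) ∧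
  σ (asH k B n (hi i)) = asH k B n (lo i) * bH k B n (lo i) ((y⁻¹ : Bˣ) : B) ∧
  (∀ z : B, σ (bH k B n (hi i) z) =
    bH k B n (lo i) (y : B) * bH k B n (lo i) z * bH k B n (lo i) ((y⁻¹ : Bˣ) : B)) ∧
  (∀ j : Fin n, j ≠ lo i → j ≠ hi i →
    σ (aH k B n j) = aH k B n j ∧ σ (asH k B n j) = asH k B n j ∧
    ∀ z : B, σ (bH k B n j z) = bH k B n j z)

open LaurentPolynomial

/-- The element `aa^* + e₀ − T` of `Â(0,0)`, generating the ideal `I`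
(here `B = k[T,T⁻¹]` and `T ∈ B` is included in `End(0)` via `b`). -/
noncomputable def gEl : HAlg k (LaurentPolynomial k) 1 :=
  aH k (LaurentPolynomial k) 1 0 * asH k (LaurentPolynomial k) 1 0 +
    eH k (LaurentPolynomial k) 1 0 - bH k (LaurentPolynomial k) 1 0 (T 1)

/-- The relation presenting the quotient `Â/I`. -/
def relI : HAlg k (LaurentPolynomial k) 1 → HAlg k (LaurentPolynomial k) 1 → Prop :=
  fun u v => u = gEl k ∧ v = 0

/-- The relations presenting the quotient `(Â/I)^{(2)} = Â^{(2)}/⟨I₁ ∪ I₂⟩`. -/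
def relI2 : HAlg k (LaurentPolynomial k) 2 → HAlg k (LaurentPolynomial k) 2 → Prop :=
  fun u v =>
    (∃ i : Fin 2, u = aH k (LaurentPolynomial k) 2 i * asH k (LaurentPolynomial k) 2 i +
      eH k (LaurentPolynomial k) 2 0 - bH k (LaurentPolynomial k) 2 i (T 1)) ∧ v = 0

section LocalizedPathAlgebra

variable (n : ℕ)

theorem eT_zero_mul_self : eT k n 0 * eT k n 0 = eT k n 0 := by
  simpa [eT] using RingQuot.mkAlgHom_rel k (TRel.idem (k := k) (n := n) 0)

theorem eT_zero_mul_aT (i : Fin n) : eT k n 0 * aT k n i = aT k n i := by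
  simpa [eT, aT] using RingQuot.mkAlgHom_rel k (TRel.aL (k := k) i)

theorem asT_mul_eT_zero (i : Fin n) : asT k n i * eT k n 0 = asT k n i := by
  simpa [eT, asT] using RingQuot.mkAlgHom_rel k (TRel.asR (k := k) i)

theorem eT_zero_mul_tinvT (i : Fin n) : eT k n 0 * tinvT k n i = tinvT k n i := by
  simpa [eT, tinvT] using RingQuot.mkAlgHom_rel k (TRel.tL (k := k) i)

theorem tinvT_mul_eT_zero (i : Fin n) : tinvT k n i * eT k n 0 = tinvT k n i := by
  simpa [eT, tinvT] using RingQuot.mkAlgHom_rel k (TRel.tR (k := k) i)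

theorem TT_mul_tinvT (i : Fin n) : TT k n i * tinvT k n i = eT k n 0 := by
  simpa [TT, eT, aT, asT, tinvT] using RingQuot.mkAlgHom_rel k (TRel.tinvR (k := k) i)

theorem tinvT_mul_TT (i : Fin n) : tinvT k n i * TT k n i = eT k n 0 := by
  simpa [TT, eT, aT, asT, tinvT] using RingQuot.mkAlgHom_rel k (TRel.tinvL (k := k) i)

theorem eT_zero_mul_TT (i : Fin n) : eT k n 0 * TT k n i = TT k n i := by
  rw [TT, mul_add, ← mul_assoc, eT_zero_mul_self, eT_zero_mul_aT]

theorem TT_mul_eT_zero (i : Fin n) : TT k n i * eT k n 0 = TT k n i := by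
  rw [TT, add_mul, mul_assoc, eT_zero_mul_self, asT_mul_eT_zero]

/-- Algebra homomorphisms out of `Ã^{(n)}` are determined by their values on the generators. -/
theorem TAlg.algHom_ext {A : Type*} [Semiring A] [Algebra k A] {f g : TAlg k n →ₐ[k] A}
    (he : ∀ i, f (eT k n i) = g (eT k n i)) (ha : ∀ i, f (aT k n i) = g (aT k n i))
    (has : ∀ i, f (asT k n i) = g (asT k n i))
    (ht : ∀ i, f (tinvT k n i) = g (tinvT k n i)) : f = g := by
  apply RingQuot.ringQuot_ext'
  apply FreeAlgebra.hom_ext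
  funext x
  cases x with
  | e i => exact he i
  | a i => exact ha i
  | as i => exact has i
  | t i => exact ht i

end LocalizedPathAlgebra

section FreeArrows

variable (n : ℕ)

theorem bH_add (i : Fin n) (x y : B) : bH k B n i (x + y) = bH k B n i x + bH k B n i y := by
  simpa [bH] using RingQuot.mkAlgHom_rel k (HRel.badd (k := k) i x y)

theorem bH_mul (i : Fin n) (x y : B) : bH k B n i (x * y) = bH k B n i x * bH k B n i y := by
  simpa [bH] using RingQuot.mkAlgHom_rel k (HRel.bmul (k := k) i x y)

theorem bH_one (i : Fin n) : bH k B n i 1 = eH k B n 0 :=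
  RingQuot.mkAlgHom_rel k (HRel.bone (k := k) i)

theorem bH_smul (i : Fin n) (c : k) (x : B) : bH k B n i (c • x) = c • bH k B n i x := by
  simpa [bH] using RingQuot.mkAlgHom_rel k (HRel.bsmul (k := k) i c x)

theorem eH_zero_mul_bH (i : Fin n) (x : B) : eH k B n 0 * bH k B n i x = bH k B n i x := by
  rw [← bH_one k B n i, ← bH_mul, one_mul]

theorem bH_mul_eH_zero (i : Fin n) (x : B) : bH k B n i x * eH k B n 0 = bH k B n i x := by
  rw [← bH_one k B n i, ← bH_mul, mul_one]

theorem eH_zero_mul_aH (i : Fin n) : eH k B n 0 * aH k B n i = aH k B n i := by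
  simpa [eH, aH] using RingQuot.mkAlgHom_rel k (HRel.aL (k := k) (B := B) i)

theorem aH_mul_eH (i : Fin n) : aH k B n i * eH k B n i.succ = aH k B n i := by
  simpa [eH, aH] using RingQuot.mkAlgHom_rel k (HRel.aR (k := k) (B := B) i)

theorem eH_mul_asH (i : Fin n) : eH k B n i.succ * asH k B n i = asH k B n i := by
  simpa [eH, asH] using RingQuot.mkAlgHom_rel k (HRel.asL (k := k) (B := B) i)

theorem asH_mul_eH_zero (i : Fin n) : asH k B n i * eH k B n 0 = asH k B n i := by
  simpa [eH, asH] using RingQuot.mkAlgHom_rel k (HRel.asR (k := k) (B := B) i)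

theorem eH_mul_self (i : Fin (n + 1)) : eH k B n i * eH k B n i = eH k B n i := by
  simpa [eH] using RingQuot.mkAlgHom_rel k (HRel.idem (k := k) (B := B) (n := n) i)

theorem eH_mul_eH_of_ne {i j : Fin (n + 1)} (h : i ≠ j) : eH k B n i * eH k B n j = 0 := by
  simpa [eH] using RingQuot.mkAlgHom_rel k (HRel.orth (k := k) (B := B) (n := n) i j h)

theorem sum_eH : ∑ i, eH k B n i = 1 := by
  simpa [eH] using RingQuot.mkAlgHom_rel k (HRel.esum (k := k) (B := B) (n := n))

theorem bH_T_mul_T_neg (i : Fin n) :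
    bH k k[T;T⁻¹] n i (T 1) * bH k k[T;T⁻¹] n i (T (-1)) = eH k k[T;T⁻¹] n 0 := by
  rw [← bH_mul, ← T_add, add_neg_cancel, T_zero, bH_one]

theorem bH_T_neg_mul_T (i : Fin n) :
    bH k k[T;T⁻¹] n i (T (-1)) * bH k k[T;T⁻¹] n i (T 1) = eH k k[T;T⁻¹] n 0 := by
  rw [← bH_mul, ← T_add, neg_add_cancel, T_zero, bH_one]

/-- The value on `T⁻¹` is determined by the values on `e₀` and `T`, as inverses in a corner
ring are unique. -/
theorem map_bH_T_neg_eq {A : Type*} [Semiring A] [Algebra k A] (f : HAlg k k[T;T⁻¹] n →ₐ[k] A)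
    (i : Fin n) {u : A} (hu : u * f (eH k k[T;T⁻¹] n 0) = u)
    (h : u * f (bH k k[T;T⁻¹] n i (T 1)) = f (eH k k[T;T⁻¹] n 0)) :
    f (bH k k[T;T⁻¹] n i (T (-1))) = u := by
  rw [← eH_zero_mul_bH, map_mul, ← h, mul_assoc, ← map_mul, bH_T_mul_T_neg, hu]

/-- Algebra homomorphisms out of `Â^{(n)}` for `B = k[T,T⁻¹]` are determined by their values on
the idempotents, the arrows and the copies of `T`. -/
theorem HAlg.algHom_ext {A : Type*} [Semiring A] [Algebra k A] {f g : HAlg k k[T;T⁻¹] n →ₐ[k] A}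
    (he : ∀ i, f (eH k k[T;T⁻¹] n i) = g (eH k k[T;T⁻¹] n i))
    (ha : ∀ i, f (aH k k[T;T⁻¹] n i) = g (aH k k[T;T⁻¹] n i))
    (has : ∀ i, f (asH k k[T;T⁻¹] n i) = g (asH k k[T;T⁻¹] n i))
    (hT : ∀ i, f (bH k k[T;T⁻¹] n i (T 1)) = g (bH k k[T;T⁻¹] n i (T 1))) : f = g := by
  have hT' (i : Fin n) :
      f (bH k k[T;T⁻¹] n i (T (-1))) = g (bH k k[T;T⁻¹] n i (T (-1))) := by
    apply map_bH_T_neg_eq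
    · rw [he, ← map_mul, bH_mul_eH_zero]
    · rw [he, hT, ← map_mul, bH_T_neg_mul_T]
  apply RingQuot.ringQuot_ext'
  apply FreeAlgebra.hom_ext
  funext x
  cases x with
  | e i => exact he i
  | a i => exact ha i
  | as i => exact has i
  | b i z =>
    change f (bH k k[T;T⁻¹] n i z) = g (bH k k[T;T⁻¹] n i z)
    induction z using LaurentPolynomial.induction_on with
    | h_C c =>
      rw [← mul_one (C c), ← smul_eq_C_mul, bH_smul, bH_one, map_smul, map_smul, he]
    | h_add hp hq => rw [bH_add, map_add, map_add, hp, hq]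
    | h_C_mul_T m c h =>
      rw [T_add, ← mul_assoc, bH_mul, map_mul, map_mul, h, hT]
    | h_C_mul_T_Z m c h =>
      rw [sub_eq_add_neg, T_add, ← mul_assoc, bH_mul, map_mul, map_mul, h, hT']

end FreeArrows

section Comparison

variable (n : ℕ)

/-- The element `T_i + (1 - e₀)`, a unit of `Ã^{(n)}` extending `T_i` by the identity on the
objects other than `0`. -/
noncomputable def unitT (i : Fin n) : (TAlg k n)ˣ where
  val := TT k n i + (1 - eT k n 0)
  inv := tinvT k n i + (1 - eT k n 0)
  val_inv := by
    simp only [mul_add, add_mul, mul_sub, sub_mul, mul_one, one_mul, TT_mul_tinvT,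
      TT_mul_eT_zero, eT_zero_mul_tinvT, eT_zero_mul_self]
    abel
  inv_val := by
    simp only [mul_add, add_mul, mul_sub, sub_mul, mul_one, one_mul, tinvT_mul_TT,
      tinvT_mul_eT_zero, eT_zero_mul_TT, eT_zero_mul_self]
    abel

/-- The algebra homomorphism `k[T,T⁻¹] → Ã^{(n)}` sending `T` to `T_i + (1 - e₀)`. -/
noncomputable def laurentToTAlg (i : Fin n) : k[T;T⁻¹] →ₐ[k] TAlg k n :=
  AddMonoidAlgebra.lift k (TAlg k n) ℤ
    ((Units.coeHom (TAlg k n)).comp (zpowersHom (TAlg k n)ˣ (unitT k n i)))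

theorem laurentToTAlg_T (i : Fin n) (m : ℤ) :
    laurentToTAlg k n i (T m) = ((unitT k n i ^ m : (TAlg k n)ˣ) : TAlg k n) := by
  refine (AddMonoidAlgebra.lift_single _ _ _).trans ?_
  simp

theorem commute_eT_zero_laurentToTAlg (i : Fin n) (z : k[T;T⁻¹]) :
    Commute (eT k n 0) (laurentToTAlg k n i z) := by
  have h : Commute (eT k n 0) (unitT k n i : TAlg k n) := by
    change eT k n 0 * (TT k n i + (1 - eT k n 0)) = (TT k n i + (1 - eT k n 0)) * eT k n 0
    rw [mul_add, add_mul, eT_zero_mul_TT, TT_mul_eT_zero, mul_sub, sub_mul, mul_one, one_mul]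
  induction z using LaurentPolynomial.induction_on' with
  | add p q hp hq => rw [map_add]; exact hp.add_right hq
  | C_mul_T m c =>
    rw [← smul_eq_C_mul, map_smul, laurentToTAlg_T]
    exact (h.units_zpow_right m).smul_right c

/-- Evaluation of Laurent polynomials at `T_i` in the endomorphism algebra of the object `0`. -/
noncomputable def evalT (i : Fin n) (z : k[T;T⁻¹]) : TAlg k n :=
  eT k n 0 * laurentToTAlg k n i z

theorem evalT_mul (i : Fin n) (x y : k[T;T⁻¹]) :
    evalT k n i (x * y) = evalT k n i x * evalT k n i y := by
  simp only [evalT, map_mul]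
  rw [mul_assoc, ← mul_assoc (laurentToTAlg k n i x),
    ← (commute_eT_zero_laurentToTAlg k n i x).eq, ← mul_assoc, ← mul_assoc, ← mul_assoc,
    eT_zero_mul_self]

theorem evalT_one (i : Fin n) : evalT k n i 1 = eT k n 0 := by
  rw [evalT, map_one, mul_one]

theorem evalT_T (i : Fin n) : evalT k n i (T 1) = TT k n i := by
  rw [evalT, laurentToTAlg_T, zpow_one]
  change eT k n 0 * (TT k n i + (1 - eT k n 0)) = TT k n i
  rw [mul_add, mul_sub, mul_one, eT_zero_mul_self, sub_self, add_zero, eT_zero_mul_TT]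

/-- The values on generators of the comparison homomorphism `Â^{(n)} → Ã^{(n)}`. -/
noncomputable def hGenToTAlg : HGen k[T;T⁻¹] n → TAlg k n
  | .e i => eT k n i
  | .a i => aT k n i
  | .as i => asT k n i
  | .b i z => evalT k n i z

/-- The comparison homomorphism `Â^{(n)} → Ã^{(n)}` sending `b_i(T)` to `T_i = e₀ + a_i a_i^*`. -/
noncomputable def hAlgToTAlg : HAlg k k[T;T⁻¹] n →ₐ[k] TAlg k n :=
  RingQuot.liftAlgHom k ⟨FreeAlgebra.lift k (hGenToTAlg k n), by
    intro u v h
    cases h with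
    | idem i => simpa [hGenToTAlg, eT] using RingQuot.mkAlgHom_rel k (TRel.idem (k := k) i)
    | orth i j h => simpa [hGenToTAlg, eT] using RingQuot.mkAlgHom_rel k (TRel.orth (k := k) i j h)
    | esum => simpa [hGenToTAlg, eT] using RingQuot.mkAlgHom_rel k (TRel.esum (k := k) (n := n))
    | aL i => simpa [hGenToTAlg] using eT_zero_mul_aT k n i
    | aR i => simpa [hGenToTAlg, eT, aT] using RingQuot.mkAlgHom_rel k (TRel.aR (k := k) i)
    | asL i => simpa [hGenToTAlg, eT, asT] using RingQuot.mkAlgHom_rel k (TRel.asL (k := k) i)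
    | asR i => simpa [hGenToTAlg] using asT_mul_eT_zero k n i
    | bL i x =>
      simpa [hGenToTAlg, evalT_one] using (evalT_mul k n i 1 x).symm
    | bR i x =>
      simpa [hGenToTAlg, evalT_one] using (evalT_mul k n i x 1).symm
    | badd i x y => simp [hGenToTAlg, evalT, mul_add]
    | bmul i x y => simpa [hGenToTAlg] using evalT_mul k n i x y
    | bone i => simpa [hGenToTAlg] using evalT_one k n i
    | bsmul i c x => simp [hGenToTAlg, evalT]⟩

theorem hAlgToTAlg_eH (i : Fin (n + 1)) : hAlgToTAlg k n (eH k k[T;T⁻¹] n i) = eT k n i := by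
  simp [hAlgToTAlg, eH, hGenToTAlg]

theorem hAlgToTAlg_aH (i : Fin n) : hAlgToTAlg k n (aH k k[T;T⁻¹] n i) = aT k n i := by
  simp [hAlgToTAlg, aH, hGenToTAlg]

theorem hAlgToTAlg_asH (i : Fin n) : hAlgToTAlg k n (asH k k[T;T⁻¹] n i) = asT k n i := by
  simp [hAlgToTAlg, asH, hGenToTAlg]

theorem hAlgToTAlg_bH_T (i : Fin n) :
    hAlgToTAlg k n (bH k k[T;T⁻¹] n i (T 1)) = TT k n i := by
  simp [hAlgToTAlg, bH, hGenToTAlg, evalT_T]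

theorem hAlgToTAlg_bH_T_neg (i : Fin n) :
    hAlgToTAlg k n (bH k k[T;T⁻¹] n i (T (-1))) = tinvT k n i := by
  apply map_bH_T_neg_eq
  · rw [hAlgToTAlg_eH, tinvT_mul_eT_zero]
  · rw [hAlgToTAlg_eH, hAlgToTAlg_bH_T, tinvT_mul_TT]

/-- The values on generators of a homomorphism from `Ã^{(n)}` to an algebra under `Â^{(n)}`. -/
noncomputable def tGenMap {A : Type*} [Semiring A] [Algebra k A]
    (f : HAlg k k[T;T⁻¹] n →ₐ[k] A) : TGen n → A
  | .e i => f (eH k k[T;T⁻¹] n i)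
  | .a i => f (aH k k[T;T⁻¹] n i)
  | .as i => f (asH k k[T;T⁻¹] n i)
  | .t i => f (bH k k[T;T⁻¹] n i (T (-1)))

/-- A homomorphism from `Â^{(n)}` under which each `b_i(T)` becomes `e₀ + a_i a_i^*` induces a
homomorphism from `Ã^{(n)}`. -/
noncomputable def tAlgLift {A : Type*} [Semiring A] [Algebra k A] (f : HAlg k k[T;T⁻¹] n →ₐ[k] A)
    (hf : ∀ i, f (eH k k[T;T⁻¹] n 0) + f (aH k k[T;T⁻¹] n i) * f (asH k k[T;T⁻¹] n i) =
      f (bH k k[T;T⁻¹] n i (T 1))) : TAlg k n →ₐ[k] A :=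
  RingQuot.liftAlgHom k ⟨FreeAlgebra.lift k (tGenMap k n f), by
    intro u v h
    cases h with
    | idem i => simpa [tGenMap] using congrArg f (eH_mul_self k _ n i)
    | orth i j h => simpa [tGenMap] using congrArg f (eH_mul_eH_of_ne k _ n h)
    | esum => simpa [tGenMap] using congrArg f (sum_eH k _ n)
    | aL i => simpa [tGenMap] using congrArg f (eH_zero_mul_aH k _ n i)
    | aR i => simpa [tGenMap] using congrArg f (aH_mul_eH k _ n i)
    | asL i => simpa [tGenMap] using congrArg f (eH_mul_asH k _ n i)
    | asR i => simpa [tGenMap] using congrArg f (asH_mul_eH_zero k _ n i)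
    | tL i => simpa [tGenMap] using congrArg f (eH_zero_mul_bH k _ n i _)
    | tR i => simpa [tGenMap] using congrArg f (bH_mul_eH_zero k _ n i _)
    | tinvR i =>
      simp only [map_mul, map_add, FreeAlgebra.lift_ι_apply, tGenMap, hf]
      rw [← map_mul, bH_T_mul_T_neg]
    | tinvL i =>
      simp only [map_mul, map_add, FreeAlgebra.lift_ι_apply, tGenMap, hf]
      rw [← map_mul, bH_T_neg_mul_T]⟩

section tAlgLift

variable {A : Type*} [Semiring A] [Algebra k A] (f : HAlg k k[T;T⁻¹] n →ₐ[k] A)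
  (hf : ∀ i, f (eH k k[T;T⁻¹] n 0) + f (aH k k[T;T⁻¹] n i) * f (asH k k[T;T⁻¹] n i) =
    f (bH k k[T;T⁻¹] n i (T 1)))

theorem tAlgLift_eT (i : Fin (n + 1)) :
    tAlgLift k n f hf (eT k n i) = f (eH k k[T;T⁻¹] n i) := by
  simp [tAlgLift, eT, tGenMap]

theorem tAlgLift_aT (i : Fin n) : tAlgLift k n f hf (aT k n i) = f (aH k k[T;T⁻¹] n i) := by
  simp [tAlgLift, aT, tGenMap]

theorem tAlgLift_asT (i : Fin n) : tAlgLift k n f hf (asT k n i) = f (asH k k[T;T⁻¹] n i) := by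
  simp [tAlgLift, asT, tGenMap]

theorem tAlgLift_tinvT (i : Fin n) :
    tAlgLift k n f hf (tinvT k n i) = f (bH k k[T;T⁻¹] n i (T (-1))) := by
  simp [tAlgLift, tinvT, tGenMap]

theorem tAlgLift_TT (i : Fin n) :
    tAlgLift k n f hf (TT k n i) = f (bH k k[T;T⁻¹] n i (T 1)) := by
  rw [TT, map_add, map_mul, tAlgLift_eT, tAlgLift_aT, tAlgLift_asT, hf]

end tAlgLift

/-- Imposing exactly the relations `a_i a_i^* + e₀ - b_i(T) = 0` on `Â^{(n)}` yields `Ã^{(n)}`. -/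
theorem exists_quotient_algEquiv_TAlg
    (r : HAlg k k[T;T⁻¹] n → HAlg k k[T;T⁻¹] n → Prop)
    (hr : ∀ u v, r u v ↔ (∃ i, u = aH k k[T;T⁻¹] n i * asH k k[T;T⁻¹] n i +
      eH k k[T;T⁻¹] n 0 - bH k k[T;T⁻¹] n i (T 1)) ∧ v = 0) :
    ∃ φ : RingQuot r ≃ₐ[k] TAlg k n,
      ∀ z, φ (RingQuot.mkAlgHom k r z) = hAlgToTAlg k n z := by
  have hf (i : Fin n) : RingQuot.mkAlgHom k r (eH k k[T;T⁻¹] n 0) +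
      RingQuot.mkAlgHom k r (aH k k[T;T⁻¹] n i) * RingQuot.mkAlgHom k r (asH k k[T;T⁻¹] n i) =
        RingQuot.mkAlgHom k r (bH k k[T;T⁻¹] n i (T 1)) := by
    have h := RingQuot.mkAlgHom_rel k ((hr _ _).2 ⟨⟨i, rfl⟩, rfl⟩)
    rw [map_sub, map_zero, sub_eq_zero, map_add, map_mul] at h
    rw [add_comm, h]
  let F : RingQuot r →ₐ[k] TAlg k n := RingQuot.liftAlgHom k ⟨hAlgToTAlg k n, by
    intro u v h
    obtain ⟨⟨i, rfl⟩, rfl⟩ := (hr u v).1 h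
    rw [map_sub, map_add, map_mul, map_zero, hAlgToTAlg_aH, hAlgToTAlg_asH, hAlgToTAlg_eH,
      hAlgToTAlg_bH_T, TT, add_comm, sub_self]⟩
  have hF (z) : F (RingQuot.mkAlgHom k r z) = hAlgToTAlg k n z :=
    RingQuot.liftAlgHom_mkAlgHom_apply ..
  refine ⟨AlgEquiv.ofAlgHom F (tAlgLift k n _ hf) ?_ ?_, hF⟩
  · apply TAlg.algHom_ext <;> intro i <;>
      simp only [AlgHom.comp_apply, AlgHom.id_apply, tAlgLift_eT, tAlgLift_aT, tAlgLift_asT,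
        tAlgLift_tinvT, hF, hAlgToTAlg_eH, hAlgToTAlg_aH, hAlgToTAlg_asH, hAlgToTAlg_bH_T_neg]
  · apply RingQuot.ringQuot_ext'
    apply HAlg.algHom_ext <;> intro i <;>
      simp only [AlgHom.comp_apply, AlgHom.id_apply, hF, hAlgToTAlg_eH, hAlgToTAlg_aH,
        hAlgToTAlg_asH, hAlgToTAlg_bH_T, tAlgLift_eT, tAlgLift_aT, tAlgLift_asT, tAlgLift_TT]

end Comparison

theorem coe_inv_unit_T_one :
    (((isUnit_T (R := k) 1).unit⁻¹ : k[T;T⁻¹]ˣ) : k[T;T⁻¹]) = T (-1) := by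
  refine Units.inv_eq_of_mul_eq_one_right ?_
  rw [IsUnit.unit_spec, ← T_add, add_neg_cancel, T_zero]

/-- The comparison homomorphism `Â^{(2)} → Ã^{(2)}` intertwines the Crisp–Paris-type operator
for `x = T`, `y = 1` with the Gelfand–MacPherson–Vilonen operator. -/
theorem hAlgToTAlg_intertwines
    (σCP : HAlg k k[T;T⁻¹] 2 →ₐ[k] HAlg k k[T;T⁻¹] 2)
    (hCP : IsCPAt k k[T;T⁻¹] (isUnit_T (R := k) 1).unit 1 2 0 σCP)
    (σG : TAlg k 2 →ₐ[k] TAlg k 2) (hG : IsGMVAt k 2 0 σG) :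
    (hAlgToTAlg k 2).comp σCP = σG.comp (hAlgToTAlg k 2) := by
  obtain ⟨c0, c1, c2, -, ca, cas, cb, ca', cas', cb', -⟩ := hCP
  obtain ⟨g0, g1, g2, -, ga, ga', gas, gas', -⟩ := hG
  have hlo : lo (n := 2) 0 = 0 := rfl
  have hhi : hi (n := 2) 0 = 1 := rfl
  simp only [hlo, hhi, coe_inv_unit_T_one, IsUnit.unit_spec, inv_one, Units.val_one, bH_one,
    eH_zero_mul_aH, asH_mul_eH_zero, eH_zero_mul_bH, bH_mul_eH_zero]
    at c1 c2 ca cas cb ca' cas' cb' g1 g2 ga ga' gas gas'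
  apply HAlg.algHom_ext
  · intro i
    simp only [AlgHom.comp_apply, hAlgToTAlg_eH]
    fin_cases i
    · exact (congrArg _ c0).trans ((hAlgToTAlg_eH k 2 _).trans g0.symm)
    · exact (congrArg _ c1).trans ((hAlgToTAlg_eH k 2 _).trans g1.symm)
    · exact (congrArg _ c2).trans ((hAlgToTAlg_eH k 2 _).trans g2.symm)
  · rw [Fin.forall_fin_two]
    simp only [AlgHom.comp_apply, ca, ca', map_mul, hAlgToTAlg_aH, hAlgToTAlg_bH_T, ga, ga',
      and_self]
  · rw [Fin.forall_fin_two]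
    simp only [AlgHom.comp_apply, cas, cas', map_mul, hAlgToTAlg_asH, hAlgToTAlg_bH_T_neg, gas,
      gas', and_self]
  · rw [Fin.forall_fin_two]
    simp only [AlgHom.comp_apply, cb, cb', map_mul, hAlgToTAlg_bH_T, hAlgToTAlg_bH_T_neg]
    constructor
    · rw [TT.eq_1 k 2 1, mul_add, add_mul, TT_mul_eT_zero, TT_mul_tinvT, TT.eq_1 k 2 0, map_add,
        map_mul, g0, ga, gas, TT.eq_1 k 2 0]
      simp only [mul_assoc]
    · simp only [TT, map_add, map_mul, g0, ga', gas']

theorem statement16 :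
    -- Â/I ≅ Ã, by an identity-on-objects k-linear isomorphism with
    -- a ↦ a, a^* ↦ a^*, T ↦ e₀ + aa^* (and T⁻¹ ↦ T⁻¹)
    (∃ φ : RingQuot (relI k) ≃ₐ[k] TAlg k 1,
      (∀ i : Fin 2,
        φ (RingQuot.mkAlgHom k (relI k) (eH k (LaurentPolynomial k) 1 i)) = eT k 1 i) ∧
      φ (RingQuot.mkAlgHom k (relI k) (aH k (LaurentPolynomial k) 1 0)) = aT k 1 0 ∧
      φ (RingQuot.mkAlgHom k (relI k) (asH k (LaurentPolynomial k) 1 0)) = asT k 1 0 ∧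
      φ (RingQuot.mkAlgHom k (relI k) (bH k (LaurentPolynomial k) 1 0 (T 1))) = TT k 1 0 ∧
      φ (RingQuot.mkAlgHom k (relI k) (bH k (LaurentPolynomial k) 1 0 (T (-1)))) =
        tinvT k 1 0) ∧
    -- moreover, on the twofold coproducts, the induced isomorphism
    -- (Â/I)^{(2)} ≅ Ã^{(2)} intertwines the Crisp–Paris-type operator
    -- (with x = T, y = 1) with the GMV operator
    (∃ φ₂ : RingQuot (relI2 k) ≃ₐ[k] TAlg k 2,
      (∀ i : Fin 3,
        φ₂ (RingQuot.mkAlgHom k (relI2 k) (eH k (LaurentPolynomial k) 2 i)) = eT k 2 i) ∧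
      (∀ i : Fin 2,
        φ₂ (RingQuot.mkAlgHom k (relI2 k) (aH k (LaurentPolynomial k) 2 i)) = aT k 2 i ∧
        φ₂ (RingQuot.mkAlgHom k (relI2 k) (asH k (LaurentPolynomial k) 2 i)) = asT k 2 i ∧
        φ₂ (RingQuot.mkAlgHom k (relI2 k) (bH k (LaurentPolynomial k) 2 i (T 1))) =
          TT k 2 i ∧
        φ₂ (RingQuot.mkAlgHom k (relI2 k) (bH k (LaurentPolynomial k) 2 i (T (-1)))) =
          tinvT k 2 i) ∧
      ∀ σCP : HAlg k (LaurentPolynomial k) 2 ≃ₐ[k] HAlg k (LaurentPolynomial k) 2,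
        IsCPAt k (LaurentPolynomial k) (isUnit_T (R := k) 1).unit 1 2 0
          (σCP : HAlg k (LaurentPolynomial k) 2 → HAlg k (LaurentPolynomial k) 2) →
        ∀ σG : TAlg k 2 ≃ₐ[k] TAlg k 2, IsGMVAt k 2 0 (σG : TAlg k 2 → TAlg k 2) →
          ∀ z : HAlg k (LaurentPolynomial k) 2,
            φ₂ (RingQuot.mkAlgHom k (relI2 k) (σCP z)) =
              σG (φ₂ (RingQuot.mkAlgHom k (relI2 k) z))) := by
  constructor
  · obtain ⟨φ, hφ⟩ := exists_quotient_algEquiv_TAlg k 1 (relI k) fun u v => by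
      simp [relI, gEl, Fin.exists_fin_one]
    exact ⟨φ, fun i => (hφ _).trans (hAlgToTAlg_eH k 1 i), (hφ _).trans (hAlgToTAlg_aH k 1 0),
      (hφ _).trans (hAlgToTAlg_asH k 1 0), (hφ _).trans (hAlgToTAlg_bH_T k 1 0),
      (hφ _).trans (hAlgToTAlg_bH_T_neg k 1 0)⟩
  · obtain ⟨φ, hφ⟩ := exists_quotient_algEquiv_TAlg k 2 (relI2 k) fun _ _ => Iff.rfl
    refine ⟨φ, fun i => (hφ _).trans (hAlgToTAlg_eH k 2 i), fun i =>
      ⟨(hφ _).trans (hAlgToTAlg_aH k 2 i), (hφ _).trans (hAlgToTAlg_asH k 2 i),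
        (hφ _).trans (hAlgToTAlg_bH_T k 2 i), (hφ _).trans (hAlgToTAlg_bH_T_neg k 2 i)⟩,
      fun σCP hCP σG hG z => ?_⟩
    rw [hφ, hφ]
    exact DFunLike.congr_fun
      (hAlgToTAlg_intertwines k σCP.toAlgHom hCP σG.toAlgHom hG) z
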